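/- Let B, u : (Fin 3 → ℝ) → (Fin 3 → ℝ) be smooth vector fields on ℝ³ and f : (Fin 3 → ℝ) → ℝ a smooth function with f x > 0 for all x. Assume div B = 0, div (fun y => f y • u y) = 0, and lie u (fun y => (f y)⁻¹ • B y) = 0 (i.e., u commutes with B/f). Then the vector field N := fun y => (B y) ×₃ (u y) satisfies curl N = 0 and ⟪N x, B x⟫ = 0 for all x; that is, the 1-form ι_u ι_B μ is closed and annihilates B. -/

import Mathlib

open Matrix
open scoped ContDiff

/-- Divergence of a vector field on `ℝ³`. -/
noncomputable def vdiv (X : (Fin 3 → ℝ) → (Fin 3 → ℝ)) (x : Fin 3 → ℝ) : ℝ :=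
  ∑ i : Fin 3, fderiv ℝ X x (Pi.single i 1) i

/-- Curl of a vector field on `ℝ³`. -/
noncomputable def vcurl (X : (Fin 3 → ℝ) → (Fin 3 → ℝ)) (x : Fin 3 → ℝ) : Fin 3 → ℝ :=
  ![fderiv ℝ X x (Pi.single 1 1) 2 - fderiv ℝ X x (Pi.single 2 1) 1,
    fderiv ℝ X x (Pi.single 2 1) 0 - fderiv ℝ X x (Pi.single 0 1) 2,
    fderiv ℝ X x (Pi.single 0 1) 1 - fderiv ℝ X x (Pi.single 1 1) 0]

/-- Lie bracket of vector fields on `ℝ³`. -/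
noncomputable def vlie (X Y : (Fin 3 → ℝ) → (Fin 3 → ℝ)) (x : Fin 3 → ℝ) : Fin 3 → ℝ :=
  fderiv ℝ Y x (X x) - fderiv ℝ X x (Y x)

/-- Product rule for the cross product of two vector fields. -/
theorem fderiv_crossProduct_apply {X Y : (Fin 3 → ℝ) → (Fin 3 → ℝ)} {x : Fin 3 → ℝ}
    (hX : DifferentiableAt ℝ X x) (hY : DifferentiableAt ℝ Y x) (v : Fin 3 → ℝ) :
    fderiv ℝ (fun y => (X y) ⨯₃ (Y y)) x v =
      (X x) ⨯₃ (fderiv ℝ Y x v) + (fderiv ℝ X x v) ⨯₃ (Y x) := by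
  have h := (crossProduct (R := ℝ)).toContinuousBilinearMap.fderiv_of_bilinear hX hY
  exact congrArg (fun L => L v) h

/-- A linear map on `ℝ³` expanded along the standard basis. -/
theorem fin_three_map_eq_sum (L : (Fin 3 → ℝ) →L[ℝ] (Fin 3 → ℝ)) (v : Fin 3 → ℝ) (i : Fin 3) :
    L v i = v 0 * L (Pi.single 0 1) i + v 1 * L (Pi.single 1 1) i
      + v 2 * L (Pi.single 2 1) i := by
  conv_lhs => rw [pi_eq_sum_univ' v]
  simp [Fin.sum_univ_three]

/-- `curl (X × Y) = (div Y) X - (div X) Y + [Y, X]`. -/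
theorem vcurl_crossProduct {X Y : (Fin 3 → ℝ) → (Fin 3 → ℝ)} {x : Fin 3 → ℝ}
    (hX : DifferentiableAt ℝ X x) (hY : DifferentiableAt ℝ Y x) :
    vcurl (fun y => (X y) ⨯₃ (Y y)) x = vdiv Y x • X x - vdiv X x • Y x + vlie Y X x := by
  ext i
  simp only [vcurl, vdiv, vlie, fderiv_crossProduct_apply hX hY, Pi.add_apply, Pi.sub_apply,
    Pi.smul_apply, fin_three_map_eq_sum _ (X x), fin_three_map_eq_sum _ (Y x),
    Fin.sum_univ_three, smul_eq_mul]
  fin_cases i <;> simp [cross_apply] <;> ring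

/-- `div (g X) = dg X + g div X`. -/
theorem vdiv_smul {g : (Fin 3 → ℝ) → ℝ} {X : (Fin 3 → ℝ) → (Fin 3 → ℝ)} {x : Fin 3 → ℝ}
    (hg : DifferentiableAt ℝ g x) (hX : DifferentiableAt ℝ X x) :
    vdiv (fun y => g y • X y) x = fderiv ℝ g x (X x) + g x * vdiv X x := by
  have h : fderiv ℝ g x (X x) = ∑ i, X x i * fderiv ℝ g x (Pi.single i 1) := by
    conv_lhs => rw [pi_eq_sum_univ' (X x)]
    simp
  simp only [vdiv, fderiv_fun_smul hg hX, h, Fin.sum_univ_three]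
  simp
  ring

/-- `[X, g Y] = (dg X) Y + g [X, Y]`. -/
theorem vlie_smul_right {g : (Fin 3 → ℝ) → ℝ} {X Y : (Fin 3 → ℝ) → (Fin 3 → ℝ)}
    {x : Fin 3 → ℝ} (hg : DifferentiableAt ℝ g x) (hY : DifferentiableAt ℝ Y x) :
    vlie X (fun y => g y • Y y) x = fderiv ℝ g x (X x) • Y x + g x • vlie X Y x := by
  simp only [vlie, fderiv_fun_smul hg hY, map_smul, smul_sub]
  simp
  abel

/-- forward conformal Noether theorem, Euclidean form: if `B` is
divergence-free, `f > 0`, `f u` is divergence-free and `u` commutes with `B/f`, then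
`N = B × u` satisfies `curl N = 0` and `⟪N, B⟫ = 0`. -/
theorem stmt_6 (B u : (Fin 3 → ℝ) → (Fin 3 → ℝ)) (f : (Fin 3 → ℝ) → ℝ)
    (hB : ContDiff ℝ ∞ B) (hu : ContDiff ℝ ∞ u) (hf : ContDiff ℝ ∞ f)
    (hfpos : ∀ x, 0 < f x)
    (hdivB : ∀ x, vdiv B x = 0)
    (hdivfu : ∀ x, vdiv (fun y => f y • u y) x = 0)
    (hlie : ∀ x, vlie u (fun y => (f y)⁻¹ • B y) x = 0) :
    (∀ x, vcurl (fun y => (B y) ⨯₃ (u y)) x = 0) ∧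
      (∀ x, ((B x) ⨯₃ (u x)) ⬝ᵥ B x = 0) := by
  refine ⟨fun x => ?_, fun x => by rw [dotProduct_comm, dot_self_cross]⟩
  have dB : Differentiable ℝ B := hB.differentiable (by simp)
  have du : Differentiable ℝ u := hu.differentiable (by simp)
  have df : Differentiable ℝ f := hf.differentiable (by simp)
  have hf0 : f x ≠ 0 := (hfpos x).ne'
  have hdiv := hdivfu x
  rw [vdiv_smul (df x) (du x)] at hdiv
  have hbracket : vlie u B x = (fderiv ℝ f x (u x) / f x) • B x := by
    have hB' : B = fun y => f y • ((f y)⁻¹ • B y) := by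
      funext y
      rw [smul_inv_smul₀ (hfpos y).ne']
    have hquot : DifferentiableAt ℝ (fun y => (f y)⁻¹ • B y) x :=
      ((df x).inv hf0).smul (dB x)
    conv_lhs => rw [hB']
    rw [vlie_smul_right (df x) hquot, hlie x, smul_zero, add_zero, smul_smul, div_eq_mul_inv]
  rw [vcurl_crossProduct (dB x) (du x), hdivB x, hbracket, zero_smul, sub_zero, ← add_smul]
  have hcoeff : vdiv u x + fderiv ℝ f x (u x) / f x = 0 := by
    field_simp
    linarith
  rw [hcoeff, zero_smul]
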